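/- Let 0 < p ≤ ∞ and 0 < v < u ≤ ∞ with v < ∞. Then for every n ∈ ℕ the operator norm of the identity between the Lorentz spaces ℓ_{p,u}^n and ℓ_{p,v}^n is exactly ‖id: ℓ_{p,u}^n → ℓ_{p,v}^n‖ = H_n^{1/v − 1/u}, where H_n = Σ_{k=1}^n 1/k is the n-th harmonic number. -/

import Mathlib

open scoped ENNReal Classical
open MeasureTheory

/-- The non-increasing rearrangement of `x : ℝ^n`: for `1 ≤ i ≤ n`,
`rearr n x i` is the `i`-th largest of the absolute values of the entries of `x`,
defined via `x_i^* = inf {t ≥ 0 : #{j : |x j| > t} ≤ i - 1}`. -/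
noncomputable def rearr (n : ℕ) (x : Fin n → ℝ) (i : ℕ) : ℝ :=
  sInf {t : ℝ | 0 ≤ t ∧ ((Finset.univ : Finset (Fin n)).filter (fun j => t < |x j|)).card ≤ i - 1}

/-- The Lorentz quasi-norm `‖x‖_{p,u}` on `ℝ^n` for `p, u ∈ (0,∞]`, with the
convention `1/∞ = 0`:  `‖x‖_{p,u} = (∑_{i=1}^n i^{u/p-1} (x_i^*)^u)^{1/u}` for `u < ∞`
and `‖x‖_{p,∞} = max_{1 ≤ i ≤ n} i^{1/p} x_i^*`. -/
noncomputable def lorentzNorm (n : ℕ) (p u : ℝ≥0∞) (x : Fin n → ℝ) : ℝ :=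
  if u = ⊤ then
    sSup {t : ℝ | ∃ i ∈ Finset.Icc 1 n, t = (i : ℝ) ^ (1 / p).toReal * rearr n x i}
  else
    (∑ i ∈ Finset.Icc 1 n, (i : ℝ) ^ ((u / p).toReal - 1) * rearr n x i ^ u.toReal) ^ (1 / u.toReal)

/-- The `k`-th (dyadic) entropy number of the identity map from `(ℝ^n, NX)` to `(ℝ^n, NY)`:
`e_k = inf {ε > 0 : ∃ y_1, …, y_{2^{k-1}} with B_X ⊆ ⋃ (y_i + ε B_Y)}`. -/
noncomputable def entropyNumber (n : ℕ) (NX NY : (Fin n → ℝ) → ℝ) (k : ℕ) : ℝ :=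
  sInf {ε : ℝ | 0 < ε ∧ ∃ T : Finset (Fin n → ℝ), T.card ≤ 2 ^ (k - 1) ∧
    ∀ x : Fin n → ℝ, NX x ≤ 1 → ∃ y ∈ T, NY (x - y) ≤ ε}

/-- The operator norm of the identity map from `(ℝ^n, NX)` to `(ℝ^n, NY)`:
`‖id‖ = sup {NY x : NX x ≤ 1}`. -/
noncomputable def opNorm (n : ℕ) (NX NY : (Fin n → ℝ) → ℝ) : ℝ :=
  sSup {t : ℝ | ∃ x : Fin n → ℝ, NX x ≤ 1 ∧ t = NY x}

theorem rearr_nonneg (n : ℕ) (x : Fin n → ℝ) (i : ℕ) : 0 ≤ rearr n x i :=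
  Real.sInf_nonneg fun _ ht => ht.1

theorem rearr_of_antitone {n : ℕ} {x : Fin n → ℝ} (hx : Antitone x) (hx0 : ∀ j, 0 ≤ x j)
    (j : Fin n) : rearr n x (j + 1) = x j := by
  refine IsLeast.csInf_eq ⟨⟨hx0 j, ?_⟩, ?_⟩
  · calc _ ≤ (Finset.Iio j).card := by
          refine Finset.card_le_card fun k hk => ?_
          rw [Finset.mem_filter, abs_of_nonneg (hx0 k)] at hk
          rw [Finset.mem_Iio]
          by_contra! h
          exact absurd (hx h) (not_le.mpr hk.2)
      _ = (j : ℕ) + 1 - 1 := by simp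
  · rintro t ⟨-, ht⟩
    by_contra! h
    have hsub : (Finset.Iic j).card ≤
        (Finset.univ.filter fun k => t < |x k|).card := by
      refine Finset.card_le_card fun k hk => ?_
      rw [Finset.mem_Iic] at hk
      rw [Finset.mem_filter, abs_of_nonneg (hx0 k)]
      exact ⟨Finset.mem_univ _, h.trans_le (hx hk)⟩
    rw [Fin.card_Iic] at hsub
    omega

/-- For finite `u`, the Lorentz quasi-norm is the `ℓ_u` quasi-norm of `i^{1/p} x_i^*`
with respect to the weights `1/i`. -/
theorem lorentzNorm_of_ne_top (n : ℕ) (p : ℝ≥0∞) {u : ℝ≥0∞} (hu : u ≠ ⊤) (x : Fin n → ℝ) :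
    lorentzNorm n p u x =
      (∑ i ∈ Finset.Icc 1 n,
        1 / (i : ℝ) * ((i : ℝ) ^ (1 / p).toReal * rearr n x i) ^ u.toReal) ^
          (1 / u.toReal) := by
  rw [lorentzNorm, if_neg hu]
  congr 1
  refine Finset.sum_congr rfl fun i hi => ?_
  have hi0 : (0 : ℝ) < i := by exact_mod_cast (Finset.mem_Icc.mp hi).1
  rw [Real.mul_rpow (by positivity) (rearr_nonneg n x i), ← Real.rpow_mul hi0.le,
    Real.rpow_sub hi0, Real.rpow_one, ENNReal.toReal_div, ENNReal.toReal_div, ENNReal.toReal_one,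
    one_div_mul_eq_div p.toReal u.toReal]
  ring

theorem rpow_mul_rearr_le_lorentzNorm_top (n : ℕ) (p : ℝ≥0∞) (x : Fin n → ℝ) {i : ℕ}
    (hi : i ∈ Finset.Icc 1 n) :
    (i : ℝ) ^ (1 / p).toReal * rearr n x i ≤ lorentzNorm n p ⊤ x := by
  rw [lorentzNorm, if_pos rfl]
  refine le_csSup ?_ ⟨i, hi, rfl⟩
  refine (((Finset.Icc 1 n).finite_toSet.image
    fun i : ℕ => (i : ℝ) ^ (1 / p).toReal * rearr n x i).subset ?_).bddAbove
  rintro t ⟨i, hi, rfl⟩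
  exact ⟨i, hi, rfl⟩

/-- Comparison of weighted `ℓ_v` and `ℓ_u` quasi-norms with finite total weight. -/
theorem weighted_rpow_sum_le {ι : Type*} (s : Finset ι) {w a : ι → ℝ} {u v : ℝ}
    (hw : ∀ i ∈ s, 0 ≤ w i) (ha : ∀ i ∈ s, 0 ≤ a i) (hW : 0 < ∑ i ∈ s, w i)
    (hv : 0 < v) (hvu : v ≤ u) :
    (∑ i ∈ s, w i * a i ^ v) ^ (1 / v) ≤
      (∑ i ∈ s, w i) ^ (1 / v - 1 / u) * (∑ i ∈ s, w i * a i ^ u) ^ (1 / u) := by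
  have hu : 0 < u := hv.trans_le hvu
  set W := ∑ i ∈ s, w i with hWdef
  have hAv : 0 ≤ ∑ i ∈ s, w i * a i ^ v :=
    Finset.sum_nonneg fun i hi => mul_nonneg (hw i hi) (Real.rpow_nonneg (ha i hi) _)
  have hAu : 0 ≤ ∑ i ∈ s, w i * a i ^ u :=
    Finset.sum_nonneg fun i hi => mul_nonneg (hw i hi) (Real.rpow_nonneg (ha i hi) _)
  have jensen := Real.rpow_arith_mean_le_arith_mean_rpow s (fun i => w i / W) (fun i => a i ^ v)
    (fun i hi => div_nonneg (hw i hi) hW.le)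
    (by rw [← Finset.sum_div, ← hWdef, div_self hW.ne'])
    (fun i hi => Real.rpow_nonneg (ha i hi) _) ((one_le_div hv).mpr hvu)
  have hl : ∑ i ∈ s, w i / W * a i ^ v = (∑ i ∈ s, w i * a i ^ v) / W := by
    rw [Finset.sum_div]
    exact Finset.sum_congr rfl fun i _ => by ring
  have hr : ∑ i ∈ s, w i / W * (a i ^ v) ^ (u / v) = (∑ i ∈ s, w i * a i ^ u) / W := by
    rw [Finset.sum_div]
    refine Finset.sum_congr rfl fun i hi => ?_
    rw [← Real.rpow_mul (ha i hi), mul_div_cancel₀ u hv.ne']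
    ring
  rw [hl, hr] at jensen
  have key := Real.rpow_le_rpow (Real.rpow_nonneg (by positivity) _) jensen
    (one_div_pos.mpr hu).le
  rw [← Real.rpow_mul (by positivity), show u / v * (1 / u) = 1 / v by field_simp,
    Real.div_rpow hAv hW.le, Real.div_rpow hAu hW.le, div_le_iff₀ (by positivity)] at key
  refine key.trans_eq ?_
  rw [Real.rpow_sub hW]
  ring

theorem sum_one_div_pos {n : ℕ} (hn : 0 < n) :
    0 < ∑ k ∈ Finset.Icc 1 n, (1 : ℝ) / (k : ℝ) :=
  Finset.sum_pos (fun k hk => by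
    have : (0 : ℝ) < k := by exact_mod_cast (Finset.mem_Icc.mp hk).1
    positivity) ⟨1, by simp; omega⟩

theorem lorentzNorm_le_harmonic {n : ℕ} (hn : 0 < n) (p : ℝ≥0∞) {u v : ℝ≥0∞} (hv : 0 < v)
    (hvu : v < u) {x : Fin n → ℝ} (hx : lorentzNorm n p u x ≤ 1) :
    lorentzNorm n p v x ≤
      (∑ k ∈ Finset.Icc 1 n, (1 : ℝ) / (k : ℝ)) ^ ((1 / v).toReal - (1 / u).toReal) := by
  have hv' : v ≠ ⊤ := hvu.ne_top
  have hv0 : 0 < v.toReal := ENNReal.toReal_pos hv.ne' hv'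
  have ha (i : ℕ) : 0 ≤ (i : ℝ) ^ (1 / p).toReal * rearr n x i :=
    mul_nonneg (by positivity) (rearr_nonneg n x i)
  have hH := sum_one_div_pos hn
  rw [lorentzNorm_of_ne_top n p hv']
  simp only [ENNReal.toReal_div 1 u, ENNReal.toReal_div 1 v, ENNReal.toReal_one]
  by_cases hu : u = ⊤
  · subst hu
    simp only [ENNReal.toReal_top, div_zero, sub_zero]
    refine Real.rpow_le_rpow (Finset.sum_nonneg fun i _ => mul_nonneg (by positivity)
      (Real.rpow_nonneg (ha i) _)) (Finset.sum_le_sum fun i hi => ?_) (by positivity)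
    exact mul_le_of_le_one_right (by positivity)
      (Real.rpow_le_one (ha i) ((rpow_mul_rearr_le_lorentzNorm_top n p x hi).trans hx) hv0.le)
  · rw [lorentzNorm_of_ne_top n p hu] at hx
    refine (weighted_rpow_sum_le (Finset.Icc 1 n) (fun i _ => by positivity) (fun i _ => ha i) hH
      hv0 ((ENNReal.toReal_le_toReal hv' hu).mpr hvu.le)).trans ?_
    exact mul_le_of_le_one_right (by positivity) hx

theorem rpow_mul_rearr_power {n : ℕ} {c s : ℝ} (hc : 0 ≤ c) (hs : 0 ≤ s) {i : ℕ}
    (hi : i ∈ Finset.Icc 1 n) :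
    (i : ℝ) ^ s * rearr n (fun j => c * ((j : ℕ) + 1 : ℝ) ^ (-s)) i = c := by
  obtain ⟨h1, h2⟩ := Finset.mem_Icc.mp hi
  have hanti : Antitone fun j : Fin n => c * ((j : ℕ) + 1 : ℝ) ^ (-s) := fun j k hjk => by
    refine mul_le_mul_of_nonneg_left
      (Real.rpow_le_rpow_of_nonpos (by positivity) ?_ (neg_nonpos.mpr hs)) hc
    have : (j : ℕ) ≤ k := hjk
    gcongr
  have h := rearr_of_antitone hanti (fun j => by positivity) ⟨i - 1, by omega⟩
  have hi' : ((i - 1 : ℕ) : ℝ) + 1 = i := by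
    exact_mod_cast Nat.sub_add_cancel h1
  simp only [Nat.sub_add_cancel h1, hi'] at h
  have hi0 : (0 : ℝ) < i := by exact_mod_cast h1
  rw [h, mul_left_comm, ← Real.rpow_add hi0, add_neg_cancel, Real.rpow_zero, mul_one]

theorem lorentzNorm_power {n : ℕ} (hn : 0 < n) (p : ℝ≥0∞) {u : ℝ≥0∞} (hu : 0 < u) {c : ℝ}
    (hc : 0 ≤ c) :
    lorentzNorm n p u (fun j => c * ((j : ℕ) + 1 : ℝ) ^ (-(1 / p).toReal)) =
      c * (∑ k ∈ Finset.Icc 1 n, (1 : ℝ) / (k : ℝ)) ^ (1 / u).toReal := by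
  by_cases h : u = ⊤
  · subst h
    rw [lorentzNorm, if_pos rfl]
    have hset : {t : ℝ | ∃ i ∈ Finset.Icc 1 n, t = (i : ℝ) ^ (1 / p).toReal *
        rearr n (fun j => c * ((j : ℕ) + 1 : ℝ) ^ (-(1 / p).toReal)) i} = {c} := by
      ext t
      constructor
      · rintro ⟨i, hi, rfl⟩
        exact rpow_mul_rearr_power hc ENNReal.toReal_nonneg hi
      · rintro rfl
        have h1 : 1 ∈ Finset.Icc 1 n := by simp; omega
        exact ⟨1, h1, (rpow_mul_rearr_power hc ENNReal.toReal_nonneg h1).symm⟩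
    rw [hset, csSup_singleton]
    simp
  · have hu0 : 0 < u.toReal := ENNReal.toReal_pos hu.ne' h
    rw [lorentzNorm_of_ne_top n p h, Finset.sum_congr rfl fun i hi => by
      rw [rpow_mul_rearr_power hc ENNReal.toReal_nonneg hi], ← Finset.sum_mul,
      Real.mul_rpow (Finset.sum_nonneg fun i _ => by positivity) (by positivity),
      ← Real.rpow_mul hc, mul_one_div_cancel hu0.ne', Real.rpow_one, mul_comm,
      ENNReal.toReal_div, ENNReal.toReal_one]

/-- For `0 < p ≤ ∞` and `0 < v < u ≤ ∞` with `v < ∞`, the operator norm of the identity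
`id : ℓ_{p,u}^n → ℓ_{p,v}^n` equals exactly `H_n^{1/v - 1/u}`, where `H_n = ∑_{k=1}^n 1/k`
is the `n`-th harmonic number. -/
theorem opNorm_lorentz_same_p_eq_harmonic
    (p u v : ℝ≥0∞) (hp : 0 < p) (hv : 0 < v) (hvu : v < u) (hv' : v ≠ ⊤) :
    ∀ n : ℕ, 0 < n →
      opNorm n (lorentzNorm n p u) (lorentzNorm n p v) =
        (∑ k ∈ Finset.Icc 1 n, (1 : ℝ) / (k : ℝ)) ^ ((1 / v).toReal - (1 / u).toReal) := by
  intro n hn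
  have hH := sum_one_div_pos hn
  have hc : 0 ≤ (∑ k ∈ Finset.Icc 1 n, (1 : ℝ) / (k : ℝ)) ^ (-(1 / u).toReal) := by positivity
  refine IsGreatest.csSup_eq ⟨⟨fun j =>
    (∑ k ∈ Finset.Icc 1 n, (1 : ℝ) / (k : ℝ)) ^ (-(1 / u).toReal) *
      ((j : ℕ) + 1 : ℝ) ^ (-(1 / p).toReal), ?_, ?_⟩, ?_⟩
  · rw [lorentzNorm_power hn p (hv.trans hvu) hc, ← Real.rpow_add hH, neg_add_cancel,
      Real.rpow_zero]
  · rw [lorentzNorm_power hn p hv hc, ← Real.rpow_add hH, neg_add_eq_sub]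
  · rintro t ⟨x, hx, rfl⟩
    exact lorentzNorm_le_harmonic hn p hv hvu hx
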